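/- Let α ∈ (1,∞), let B and 𝒞 be finite sets, let p be a probability distribution on B, for each b ∈ B let p(·|b) be a probability distribution on 𝒞, and let d : B×𝒞 → ℝ. Then the function F : ℝ^𝒞 → ℝ defined by F(f) := (α/(1−α))·log( Σ_b p(b)·( Σ_c p(c|b)^α · 2^{(α−1)·(d(b,c) + f_c)} )^{1/α} ) is concave on ℝ^𝒞. -/

import Mathlib

/-- Hölder's inequality for weighted geometric means of nonnegative families. -/
theorem Real.sum_rpow_mul_rpow_le {ι : Type*} (s : Finset ι) {x y : ι → ℝ}
    (hx : ∀ i, 0 ≤ x i) (hy : ∀ i, 0 ≤ y i) {a b : ℝ} (ha : 0 < a) (hb : 0 < b)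
    (hab : a + b = 1) :
    ∑ i ∈ s, x i ^ a * y i ^ b ≤ (∑ i ∈ s, x i) ^ a * (∑ i ∈ s, y i) ^ b := by
  have h := Real.inner_le_Lp_mul_Lq_of_nonneg s
    (Real.HolderConjugate.inv_inv ha hb hab)
    (f := fun i => x i ^ a) (g := fun i => y i ^ b)
    (fun i _ => Real.rpow_nonneg (hx i) a) (fun i _ => Real.rpow_nonneg (hy i) b)
  simpa only [Real.rpow_rpow_inv (hx _) ha.ne', Real.rpow_rpow_inv (hy _) hb.ne',
    one_div, inv_inv] using h

/-- Weighted sums preserve log-convexity inequalities. -/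
theorem Real.weighted_sum_le_rpow_mul_rpow {ι : Type*} (s : Finset ι) {w x y z : ι → ℝ}
    (hw : ∀ i, 0 ≤ w i) (hx : ∀ i, 0 ≤ x i) (hy : ∀ i, 0 ≤ y i)
    {a b : ℝ} (ha : 0 < a) (hb : 0 < b) (hab : a + b = 1)
    (hz : ∀ i, z i ≤ x i ^ a * y i ^ b) :
    ∑ i ∈ s, w i * z i ≤ (∑ i ∈ s, w i * x i) ^ a * (∑ i ∈ s, w i * y i) ^ b := by
  refine le_trans (Finset.sum_le_sum fun i _ => ?_) (Real.sum_rpow_mul_rpow_le s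
    (fun i => mul_nonneg (hw i) (hx i)) (fun i => mul_nonneg (hw i) (hy i)) ha hb hab)
  have hwi : w i ^ a * w i ^ b = w i := by
    rw [← Real.rpow_add' (hw i) (by simp [hab]), hab, Real.rpow_one]
  rw [Real.mul_rpow (hw i) (hx i), Real.mul_rpow (hw i) (hy i), mul_mul_mul_comm, hwi]
  exact mul_le_mul_of_nonneg_left (hz i) (hw i)

/-- A sum of positive terms weighted by powers of a probability vector is positive. -/
theorem Finset.sum_rpow_mul_pos_of_sum_eq_one {ι : Type*} {s : Finset ι} {w x : ι → ℝ}
    (hw : ∀ i, 0 ≤ w i) (hw1 : ∑ i ∈ s, w i = 1) {r : ℝ} (hx : ∀ i, 0 < x i) :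
    0 < ∑ i ∈ s, w i ^ r * x i := by
  obtain ⟨i, hi, hwi⟩ : ∃ i ∈ s, w i ≠ 0 :=
    Finset.exists_ne_zero_of_sum_ne_zero (by simp [hw1])
  exact Finset.sum_pos' (fun j _ => mul_nonneg (Real.rpow_nonneg (hw j) r) (hx j).le)
    ⟨i, hi, mul_pos (Real.rpow_pos_of_pos ((hw i).lt_of_ne' hwi) r) (hx i)⟩

/-- **concavity in the trade-off vector.** For `α ∈ (1,∞)`,
a probability distribution `p` on a finite set `B`, conditional distributions
`p(·|b)` on a finite set `𝒞`, and `d : B × 𝒞 → ℝ`, the function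
`F(f) = (α/(1−α))·log(Σ_b p(b)·(Σ_c p(c|b)^α·2^{(α−1)(d(b,c)+f_c)})^{1/α})`
is concave on `ℝ^𝒞`. This is the closed-form expression of the optimized
`f`-weighted Rényi entropy `sup_q H_α^f(AC|BE)_{p|σ_q}` as a function of `f`. -/
theorem stmt11 {B C : Type} [Fintype B] [Fintype C]
    (α : ℝ) (hα : 1 < α)
    (p : B → ℝ) (hp0 : ∀ b, 0 ≤ p b) (hp1 : ∑ b, p b = 1)
    (pc : B → C → ℝ) (hpc0 : ∀ b c, 0 ≤ pc b c) (hpc1 : ∀ b, ∑ c, pc b c = 1)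
    (d : B → C → ℝ) :
    ConcaveOn ℝ Set.univ (fun f : C → ℝ =>
      (α / (1 - α)) * Real.logb 2
        (∑ b, p b * (∑ c, pc b c ^ α *
          (2 : ℝ) ^ ((α - 1) * (d b c + f c))) ^ (1 / α : ℝ))) := by
  have hα0 : 0 < α := by linarith
  set S : (C → ℝ) → B → ℝ := fun f b =>
    ∑ c, pc b c ^ α * (2 : ℝ) ^ ((α - 1) * (d b c + f c))
  set G : (C → ℝ) → ℝ := fun f => ∑ b, p b * S f b ^ (1 / α : ℝ)
  have hSpos (f : C → ℝ) (b : B) : 0 < S f b :=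
    Finset.sum_rpow_mul_pos_of_sum_eq_one (hpc0 b) (hpc1 b) fun c => by positivity
  have hGpos (f : C → ℝ) : 0 < G f := by
    simpa only [Real.rpow_one] using
      Finset.sum_rpow_mul_pos_of_sum_eq_one (r := 1) hp0 hp1
        fun b => Real.rpow_pos_of_pos (hSpos f b) (1 / α)
  refine concaveOn_iff_forall_pos.2 ⟨convex_univ, fun f _ g _ a b ha hb hab => ?_⟩
  have hSle (i : B) : S (a • f + b • g) i ≤ S f i ^ a * S g i ^ b := by
    refine Real.weighted_sum_le_rpow_mul_rpow Finset.univ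
      (fun c => Real.rpow_nonneg (hpc0 i c) α) (fun c => by positivity)
      (fun c => by positivity) ha hb hab fun c => le_of_eq ?_
    rw [← Real.rpow_mul zero_le_two, ← Real.rpow_mul zero_le_two, ← Real.rpow_add two_pos]
    congr 1
    simp only [Pi.add_apply, Pi.smul_apply, smul_eq_mul]
    linear_combination -(α - 1) * d i c * hab
  have hGle : G (a • f + b • g) ≤ G f ^ a * G g ^ b := by
    refine Real.weighted_sum_le_rpow_mul_rpow Finset.univ hp0
      (fun i => Real.rpow_nonneg (hSpos f i).le _)
      (fun i => Real.rpow_nonneg (hSpos g i).le _) ha hb hab fun i => ?_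
    rw [← Real.rpow_mul (hSpos f i).le, ← Real.rpow_mul (hSpos g i).le,
      mul_comm _ a, mul_comm _ b, Real.rpow_mul (hSpos f i).le, Real.rpow_mul (hSpos g i).le,
      ← Real.mul_rpow (Real.rpow_nonneg (hSpos f i).le a) (Real.rpow_nonneg (hSpos g i).le b)]
    exact Real.rpow_le_rpow (hSpos _ i).le (hSle i) (by positivity)
  have hlog : Real.logb 2 (G (a • f + b • g)) ≤
      a * Real.logb 2 (G f) + b * Real.logb 2 (G g) := by
    rw [← Real.logb_rpow_eq_mul_logb_of_pos (hGpos f),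
      ← Real.logb_rpow_eq_mul_logb_of_pos (hGpos g),
      ← Real.logb_mul (Real.rpow_pos_of_pos (hGpos f) a).ne'
        (Real.rpow_pos_of_pos (hGpos g) b).ne']
    exact Real.logb_le_logb_of_le one_lt_two (hGpos _) hGle
  have hneg : α / (1 - α) ≤ 0 := div_nonpos_of_nonneg_of_nonpos hα0.le (by linarith)
  change a * (α / (1 - α) * Real.logb 2 (G f)) + b * (α / (1 - α) * Real.logb 2 (G g)) ≤
    α / (1 - α) * Real.logb 2 (G (a • f + b • g))
  linarith [mul_le_mul_of_nonpos_left hlog hneg]
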